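/- Let n and k be integers with 2 ≤ k ≤ n−3, and let G ∈ 𝒢_n^k with G not isomorphic to K_n^k be such that H ⪯_s G for every H ∈ 𝒢_n^k not isomorphic to K_n^k (i.e., G is last in the S-order among 𝒢_n^k \ {K_n^k}). Then every connected component of the graph obtained from G by deleting all of its cut edges is a complete graph. -/

import Mathlib

open SimpleGraph

/-- The `k`-th spectral moment of a graph: the trace of the `k`-th power of its
adjacency matrix. -/
noncomputable def specMoment {V : Type*} [Fintype V] (G : SimpleGraph V) (k : ℕ) : ℝ :=
  letI := Classical.decEq V
  letI : DecidableRel G.Adj := Classical.decRel _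
  Matrix.trace ((G.adjMatrix ℝ) ^ k)

/-- The strict lexicographic order by spectral moments (`S`-order) for graphs on
`n` vertices. -/
def SLt {V W : Type*} [Fintype V] [Fintype W] (n : ℕ)
    (G : SimpleGraph V) (H : SimpleGraph W) : Prop :=
  ∃ k, 1 ≤ k ∧ k ≤ n - 1 ∧ (∀ i, i < k → specMoment G i = specMoment H i) ∧
    specMoment G k < specMoment H k

/-- The weak `S`-order: `G ⪯_s H` iff `G ≺_s H` or all spectral moments
`S_0, …, S_{n-1}` of `G` and `H` coincide. -/
def SLe {V W : Type*} [Fintype V] [Fintype W] (n : ℕ)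
    (G : SimpleGraph V) (H : SimpleGraph W) : Prop :=
  SLt n G H ∨ ∀ i, i < n → specMoment G i = specMoment H i

/-- The number of cut edges (bridges) of a graph. -/
noncomputable def numBridges {V : Type*} (G : SimpleGraph V) : ℕ :=
  {e : Sym2 V | G.IsBridge e}.ncard

/-- `KnK n k`: the `n`-vertex graph obtained from the complete graph `K_{n-k}`
(on the first `n - k` vertices) by attaching `k` pendant vertices to the
vertex `0` of the clique. -/
def KnK (n k : ℕ) : SimpleGraph (Fin n) :=
  SimpleGraph.fromRel (fun i j =>
    ((i : ℕ) < n - k ∧ (j : ℕ) < n - k) ∨ ((i : ℕ) = 0 ∧ n - k ≤ (j : ℕ)))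

theorem reach_of_adj_reach {V : Type*} {A B : SimpleGraph V}
    (h : ∀ a b, A.Adj a b → B.Reachable a b) {u v : V} (huv : A.Reachable u v) :
    B.Reachable u v := by
  obtain ⟨p⟩ := huv
  induction p with
  | nil => exact Reachable.refl _
  | cons hadj _ ih => exact (h _ _ hadj).trans ih

theorem specMoment_zero_eq {V : Type*} [Fintype V] (G H : SimpleGraph V) :
    specMoment G 0 = specMoment H 0 := by
  simp [specMoment]

theorem specMoment_one_eq {V : Type*} [Fintype V] (G : SimpleGraph V) :
    specMoment G 1 = 0 := by
  simp [specMoment]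

theorem specMoment_two_eq {V : Type*} [Fintype V] (G : SimpleGraph V) :
    specMoment G 2 = 2 * (G.edgeSet.ncard : ℝ) := by
  classical
  have h : specMoment G 2 = Matrix.trace ((G.adjMatrix ℝ) ^ 2) := by
    unfold specMoment
    congr!
  rw [h, pow_two, Matrix.trace]
  simp only [Matrix.diag, adjMatrix_mul_self_apply_self]
  rw [← Nat.cast_sum, sum_degrees_eq_twice_card_edges, ← coe_edgeFinset, Set.ncard_coe_finset]
  push_cast
  rfl

theorem not_SLe_of_edges {n : ℕ} (hn : 3 ≤ n) (H G : SimpleGraph (Fin n))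
    (h : G.edgeSet.ncard < H.edgeSet.ncard) : ¬ SLe n H G := by
  have h2 : specMoment G 2 < specMoment H 2 := by
    rw [specMoment_two_eq, specMoment_two_eq]
    have : (G.edgeSet.ncard : ℝ) < H.edgeSet.ncard := by exact_mod_cast h
    linarith
  rintro (⟨k, hk1, hk2, heq, hlt⟩ | hall)
  · have hk : k = 1 ∨ k = 2 ∨ 2 < k := by omega
    rcases hk with rfl | rfl | hk
    · simp [specMoment_one_eq] at hlt
    · exact lt_asymm h2 hlt
    · exact absurd (heq 2 hk) (ne_of_gt h2)
  · exact absurd (hall 2 (by omega)) (ne_of_gt h2)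

/-- Clique on the first `m` vertices; every other vertex `j` is pendant at `f j`. -/
def PG (n m : ℕ) (f : Fin n → Fin n) : SimpleGraph (Fin n) :=
  SimpleGraph.fromRel (fun i j =>
    ((i : ℕ) < m ∧ (j : ℕ) < m) ∨ (i = f j ∧ m ≤ (j : ℕ)))

theorem PG_adj {n m : ℕ} {f : Fin n → Fin n} {i j : Fin n} :
    (PG n m f).Adj i j ↔ i ≠ j ∧ (((i : ℕ) < m ∧ (j : ℕ) < m) ∨
      (i = f j ∧ m ≤ (j : ℕ)) ∨ (j = f i ∧ m ≤ (i : ℕ))) := by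
  simp only [PG, fromRel_adj]
  tauto

theorem pend_injOn {n m : ℕ} {f : Fin n → Fin n} (hf : ∀ j, (f j : ℕ) < m) :
    Set.InjOn (fun j : Fin n => s(f j, j)) {j | m ≤ (j : ℕ)} := by
  intro a ha b hb hab
  simp only [Set.mem_ofPred_eq] at ha hb
  simp only [Sym2.eq_iff] at hab
  rcases hab with h | h
  · exact h.2
  · have := hf a
    rw [h.1] at this
    omega

theorem pend_ncard {n m : ℕ} {f : Fin n → Fin n} (hf : ∀ j, (f j : ℕ) < m) :
    ((fun j : Fin n => s(f j, j)) '' {j | m ≤ (j : ℕ)}).ncard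
      = {j : Fin n | m ≤ (j : ℕ)}.ncard :=
  (pend_injOn hf).ncard_image

theorem PG_edge_ncard {n m : ℕ} {f : Fin n → Fin n} (hf : ∀ j, (f j : ℕ) < m) :
    (PG n m f).edgeSet.ncard =
      (SimpleGraph.fromRel (fun i j : Fin n => (i : ℕ) < m ∧ (j : ℕ) < m)).edgeSet.ncard
        + {j : Fin n | m ≤ (j : ℕ)}.ncard := by
  rw [← pend_ncard hf, ← Set.ncard_union_eq]
  · congr 1
    ext e
    induction e with | h a b
    have ha := hf a
    have hb := hf b
    simp only [mem_edgeSet, PG_adj, Set.mem_union, fromRel_adj, Set.mem_image, Set.mem_ofPred_eq,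
      Sym2.eq_iff]
    constructor
    · rintro ⟨h1, h | h | h⟩
      · exact Or.inl ⟨h1, Or.inl h⟩
      · exact Or.inr ⟨b, h.2, Or.inl ⟨h.1.symm, rfl⟩⟩
      · exact Or.inr ⟨a, h.2, Or.inr ⟨h.1.symm, rfl⟩⟩
    · rintro (h | ⟨j, hj, ⟨h1, rfl⟩ | ⟨h1, rfl⟩⟩)
      · exact ⟨h.1, Or.inl (by tauto)⟩
      · refine ⟨?_, Or.inr (Or.inl ⟨h1.symm, hj⟩)⟩
        rintro rfl
        omega
      · refine ⟨?_, Or.inr (Or.inr ⟨h1.symm, hj⟩)⟩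
        rintro rfl
        omega
  · rw [Set.disjoint_left]
    rintro e he ⟨j, hj, rfl⟩
    simp only [mem_edgeSet, fromRel_adj, Set.mem_ofPred_eq] at he hj
    omega

theorem PG_connected {n m : ℕ} {f : Fin n → Fin n} (hf : ∀ j, (f j : ℕ) < m) (hn : 0 < n) :
    (PG n m f).Connected := by
  rw [connected_iff_exists_forall_reachable]
  have key : ∀ w : Fin n, (w : ℕ) < m → (PG n m f).Reachable ⟨0, hn⟩ w := by
    intro w hw
    by_cases h : (⟨0, hn⟩ : Fin n) = w
    · rw [h]
    · exact Adj.reachable (PG_adj.2 ⟨h, Or.inl ⟨by simp only []; omega, hw⟩⟩)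
  refine ⟨⟨0, hn⟩, fun w => ?_⟩
  by_cases hw : (w : ℕ) < m
  · exact key w hw
  · refine (key (f w) (hf w)).trans (Adj.reachable (PG_adj.2 ⟨?_, Or.inr (Or.inl ⟨rfl, by omega⟩)⟩))
    intro h
    have := hf w
    rw [h] at this
    exact hw this

theorem PG_bridges {n m : ℕ} {f : Fin n → Fin n} (hf : ∀ j, (f j : ℕ) < m) (hm : 3 ≤ m)
    (hmn : m ≤ n) :
    {e | (PG n m f).IsBridge e} = (fun j : Fin n => s(f j, j)) '' {j | m ≤ (j : ℕ)} := by
  ext e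
  induction e with | h a b
  constructor
  · intro he
    have he' : (PG n m f).IsBridge s(a, b) := he
    have hadj : (PG n m f).Adj a b :=
      he'.reachable_iff_adj.1 ((PG_connected hf (by omega)).preconnected a b)
    rcases PG_adj.1 hadj with ⟨hne, h | h | h⟩
    · exfalso
      obtain ⟨c, hc, hca, hcb⟩ : ∃ c : Fin n, (c : ℕ) < m ∧ c ≠ a ∧ c ≠ b := by
        by_cases h0 : (a : ℕ) ≠ 0 ∧ (b : ℕ) ≠ 0
        · exact ⟨⟨0, by omega⟩, by simp only []; omega, by simp only [ne_eq, Fin.ext_iff]; omega,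
            by simp only [ne_eq, Fin.ext_iff]; omega⟩
        by_cases h1 : (a : ℕ) ≠ 1 ∧ (b : ℕ) ≠ 1
        · exact ⟨⟨1, by omega⟩, by simp only []; omega, by simp only [ne_eq, Fin.ext_iff]; omega,
            by simp only [ne_eq, Fin.ext_iff]; omega⟩
        exact ⟨⟨2, by omega⟩, by simp only []; omega, by simp only [ne_eq, Fin.ext_iff]; omega,
            by simp only [ne_eq, Fin.ext_iff]; omega⟩
      refine isBridge_iff.1 he' ?_
      have h1 : ((PG n m f).deleteEdges {s(a, b)}).Adj a c := by
        rw [deleteEdges_adj]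
        refine ⟨PG_adj.2 ⟨hca.symm, Or.inl ⟨h.1, hc⟩⟩, ?_⟩
        simp only [Set.mem_singleton_iff, Sym2.eq_iff]
        tauto
      have h2 : ((PG n m f).deleteEdges {s(a, b)}).Adj c b := by
        rw [deleteEdges_adj]
        refine ⟨PG_adj.2 ⟨hcb, Or.inl ⟨hc, h.2⟩⟩, ?_⟩
        simp only [Set.mem_singleton_iff, Sym2.eq_iff]
        tauto
      exact h1.reachable.trans h2.reachable
    · exact ⟨b, h.2, by simp [h.1]⟩
    · exact ⟨a, h.2, by simp [h.1, Sym2.eq_swap]⟩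
  · rintro ⟨j, hj, hje⟩
    rw [← hje]
    change (PG n m f).IsBridge s(f j, j)
    rw [isBridge_iff]
    intro hr
    have hj' : m ≤ (j : ℕ) := hj
    have hne : f j ≠ j := by
      intro h
      have := hf j
      rw [h] at this
      omega
    obtain ⟨w, hw⟩ := Reachable.nonempty_neighborSet_right hne hr
    rw [mem_neighborSet, deleteEdges_adj, PG_adj] at hw
    obtain ⟨⟨_, h | h | h⟩, hw2⟩ := hw
    · omega
    · have := hf w
      rw [← h.1] at this
      omega
    · rw [h.1] at hw2
      exact hw2 (by simp [Sym2.eq_swap])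

theorem card_tail {n k : ℕ} (hk : k ≤ n) : {j : Fin n | n - k ≤ (j : ℕ)}.ncard = k := by
  have h : {j : Fin n | n - k ≤ (j : ℕ)}.ncard = (Set.Ico (n - k) n).ncard := by
    rw [← Set.ncard_image_of_injective _ Fin.val_injective]
    congr 1
    ext x
    simp only [Set.mem_image, Set.mem_ofPred_eq, Set.mem_Ico]
    constructor
    · rintro ⟨j, hj, rfl⟩
      exact ⟨hj, j.2⟩
    · rintro ⟨h1, h2⟩
      exact ⟨⟨x, h2⟩, h1, rfl⟩
  rw [h, ← Finset.coe_Ico, Set.ncard_coe_finset, Nat.card_Ico]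
  omega

theorem KnK_eq {n k : ℕ} (hn : 0 < n) : KnK n k = PG n (n - k) (fun _ => ⟨0, hn⟩) := by
  unfold KnK PG
  congr 1
  ext i j
  simp [Fin.ext_iff]

theorem iso_edges {n : ℕ} {G H : SimpleGraph (Fin n)} (e : G ≃g H) :
    G.edgeSet.ncard = H.edgeSet.ncard := by
  rw [← Nat.card_coe_set_eq, ← Nat.card_coe_set_eq]
  exact Nat.card_congr e.mapEdgeSet

/-- The competitor: one pendant vertex is attached to vertex `1`, the others to `0`. -/
theorem exists_competitor {n k : ℕ} (hk2 : 2 ≤ k) (hk : k ≤ n - 3) :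
    ∃ H : SimpleGraph (Fin n), H.Connected ∧ numBridges H = k ∧ ¬ Nonempty (H ≃g KnK n k) ∧
      H.edgeSet.ncard = (KnK n k).edgeSet.ncard := by
  have hn : 0 < n := by omega
  let f : Fin n → Fin n := fun j => if (j : ℕ) = n - 1 then ⟨1, by omega⟩ else ⟨0, hn⟩
  have hf : ∀ j, (f j : ℕ) < n - k := by
    intro j
    simp only [f]
    split_ifs <;> simp only [] <;> omega
  have hf0 : ∀ j : Fin n, (((⟨0, hn⟩ : Fin n) : ℕ)) < n - k := by
    intro j
    simp only []
    omega
  refine ⟨PG n (n - k) f, PG_connected hf hn, ?_, ?_, ?_⟩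
  · rw [numBridges, PG_bridges hf (by omega) (by omega), pend_ncard hf, card_tail (by omega)]
  · rintro ⟨e⟩
    rw [KnK_eq hn] at e
    have huniv : ∀ w, w ≠ e.symm ⟨0, hn⟩ → (PG n (n - k) f).Adj (e.symm ⟨0, hn⟩) w := by
      intro w hw
      rw [← e.map_adj_iff, RelIso.apply_symm_apply, PG_adj]
      have hne : (⟨0, hn⟩ : Fin n) ≠ e w := by
        intro h
        exact hw ((e.symm_apply_apply w).symm.trans (congrArg e.symm h.symm))
      refine ⟨hne, ?_⟩
      by_cases h : ((e w : Fin n) : ℕ) < n - k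
      · exact Or.inl ⟨by simp only []; omega, h⟩
      · exact Or.inr (Or.inl ⟨rfl, by omega⟩)
    generalize e.symm ⟨0, hn⟩ = c at huniv
    simp only [PG_adj, f] at huniv
    by_cases hc : (c : ℕ) < n - k
    · by_cases hc1 : (c : ℕ) = 1
      · have := huniv ⟨n - k, by omega⟩ (by simp only [ne_eq, Fin.ext_iff]; omega)
        rw [if_neg (by simp only []; omega)] at this
        simp only [ne_eq, Fin.ext_iff] at this
        omega
      · have := huniv ⟨n - 1, by omega⟩ (by simp only [ne_eq, Fin.ext_iff]; omega)
        rw [if_pos rfl] at this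
        simp only [ne_eq, Fin.ext_iff] at this
        omega
    · have h0 := huniv ⟨0, by omega⟩ (by simp only [ne_eq, Fin.ext_iff]; omega)
      have h1 := huniv ⟨1, by omega⟩ (by simp only [ne_eq, Fin.ext_iff]; omega)
      split_ifs at h0 h1 <;> simp only [ne_eq, Fin.ext_iff] at h0 h1 <;> omega
  · rw [PG_edge_ncard hf, KnK_eq hn, PG_edge_ncard hf0]

theorem components_of_second_last_are_complete (n k : ℕ) (hk2 : 2 ≤ k) (hk : k ≤ n - 3)
    (G : SimpleGraph (Fin n)) (hconn : G.Connected) (hbr : numBridges G = k)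
    (hne : ¬ Nonempty (G ≃g KnK n k))
    (hlast : ∀ H : SimpleGraph (Fin n), H.Connected → numBridges H = k →
      ¬ Nonempty (H ≃g KnK n k) → SLe n H G) :
    ∀ u v : Fin n, u ≠ v →
      (G.deleteEdges {e | G.IsBridge e}).Reachable u v →
      (G.deleteEdges {e | G.IsBridge e}).Adj u v := by
  intro u v huv hreach
  by_contra hnadj
  -- `u` and `v` remain reachable after deleting a single bridge
  have hdel : ∀ e, G.IsBridge e → (G.deleteEdges {e}).Reachable u v := fun e he =>
    hreach.mono (deleteEdges_anti (by
      rintro x rfl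
      exact he))
  have hGnadj : ¬ G.Adj u v := by
    intro h
    apply hnadj
    rw [deleteEdges_adj]
    exact ⟨h, fun hb => isBridge_iff.1 hb (hdel _ hb)⟩
  have hle : G ≤ G ⊔ edge u v := le_sup_left
  have hlt : G.edgeSet.ncard < (G ⊔ edge u v).edgeSet.ncard := by
    apply Set.ncard_lt_ncard _ (Set.toFinite _)
    rw [edgeSet_ssubset_edgeSet]
    refine lt_of_le_of_ne hle fun h => hGnadj ?_
    rw [h]
    simp [edge_adj, huv]
  have hbridges : numBridges (G ⊔ edge u v) = k := by
    rw [← hbr, numBridges, numBridges]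
    congr 1
    ext e
    refine ⟨fun h => IsBridge.anti hle h, fun h => ?_⟩
    have h' : G.IsBridge e := h
    have hd := hdel e h'
    induction e with | h a b
    change (G ⊔ edge u v).IsBridge s(a, b)
    rw [isBridge_iff] at h' ⊢
    intro hr
    refine h' (reach_of_adj_reach ?_ hr)
    intro x y hxy
    rw [deleteEdges_adj, sup_adj, edge_adj] at hxy
    obtain ⟨h1 | ⟨⟨rfl, rfl⟩ | ⟨rfl, rfl⟩, _⟩, h2⟩ := hxy
    · exact Adj.reachable (deleteEdges_adj.2 ⟨h1, h2⟩)
    · exact hd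
    · exact hd.symm
  by_cases hiso : Nonempty ((G ⊔ edge u v) ≃g KnK n k)
  · obtain ⟨e⟩ := hiso
    obtain ⟨H, hHc, hHb, hHn, hHe⟩ := exists_competitor hk2 hk
    refine not_SLe_of_edges (by omega) H G ?_ (hlast H hHc hHb hHn)
    rw [hHe, ← iso_edges e]
    exact hlt
  · exact not_SLe_of_edges (by omega) _ G hlt (hlast _ (hconn.mono hle) hbridges hiso)
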